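/- Let Δ be a finite chamber complex with the gate property, let C be a chamber, and let ≤_C be the geodesic partial order on chambers. Then every linear extension of ≤_C is a shelling of Δ; in particular, every finite chamber complex with the gate property is shellable. -/

import Mathlib

open scoped Classical

/-- A finite abstract simplicial complex on a vertex type `V`. -/
structure Cplx (V : Type*) [DecidableEq V] where
  faces : Finset (Finset V)
  empty_mem : ∅ ∈ faces
  down_closed : ∀ F ∈ faces, ∀ G, G ⊆ F → G ∈ faces

namespace Cplx

variable {V : Type*} [DecidableEq V]

/-- A chamber is a maximal face. -/
def Chamber (Δ : Cplx V) (D : Finset V) : Prop :=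
  D ∈ Δ.faces ∧ ∀ E ∈ Δ.faces, D ⊆ E → E = D

/-- `Δ` is pure of rank `n` (dimension `n-1`): every chamber has `n` vertices. -/
def Pure (Δ : Cplx V) (n : ℕ) : Prop :=
  ∀ D, Δ.Chamber D → D.card = n

/-- `G` is a facet (codimension-one face) of the chamber `D`. -/
def IsFacetOf (Δ : Cplx V) (G D : Finset V) : Prop :=
  G ⊆ D ∧ G.card + 1 = D.card

/-- Two distinct chambers are adjacent if they share a common facet. -/
def Adjacent (Δ : Cplx V) (D E : Finset V) : Prop :=
  Δ.Chamber D ∧ Δ.Chamber E ∧ D ≠ E ∧ ∃ G, G ⊆ D ∧ G ⊆ E ∧ G.card + 1 = D.card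

/-- There is a gallery of length `k` from `D` to `E`. -/
def HasGallery (Δ : Cplx V) (D E : Finset V) (k : ℕ) : Prop :=
  ∃ g : ℕ → Finset V, g 0 = D ∧ g k = E ∧ (∀ i, i ≤ k → Δ.Chamber (g i)) ∧
    ∀ i, i < k → Δ.Adjacent (g i) (g (i + 1))

/-- The gallery distance between two chambers. -/
noncomputable def gdist (Δ : Cplx V) (D E : Finset V) : ℕ :=
  sInf {k | Δ.HasGallery D E k}

/-- `Δ` is gallery connected. -/
def GalleryConnected (Δ : Cplx V) : Prop :=
  ∀ D E, Δ.Chamber D → Δ.Chamber E → ∃ k, Δ.HasGallery D E k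

/-- The gate property. -/
def GateProperty (Δ : Cplx V) : Prop :=
  ∀ F ∈ Δ.faces, ∀ C, Δ.Chamber C → ∃ D, Δ.Chamber D ∧ F ⊆ D ∧
    ∀ E, Δ.Chamber E → F ⊆ E → Δ.gdist C E = Δ.gdist C D + Δ.gdist D E

end Cplx

/-- `r` is a linear order on the set of chambers of `Δ`. -/
def LinOrderOn {V : Type*} [DecidableEq V] (Δ : Cplx V)
    (r : Finset V → Finset V → Prop) : Prop :=
  (∀ D, Δ.Chamber D → r D D) ∧
  (∀ D E, Δ.Chamber D → Δ.Chamber E → r D E → r E D → D = E) ∧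
  (∀ D E F, Δ.Chamber D → Δ.Chamber E → Δ.Chamber F → r D E → r E F → r D F) ∧
  (∀ D E, Δ.Chamber D → Δ.Chamber E → r D E ∨ r E D)

/-- `F` is a face of `D` contained in some chamber strictly earlier than `D`
in the order `r`. -/
def EarlierFace {V : Type*} [DecidableEq V] (Δ : Cplx V)
    (r : Finset V → Finset V → Prop) (D F : Finset V) : Prop :=
  ∃ E, Δ.Chamber E ∧ E ≠ D ∧ r E D ∧ F ⊆ E

/-- `r` is a shelling of `Δ`. -/
def IsShelling {V : Type*} [DecidableEq V] (Δ : Cplx V)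
    (r : Finset V → Finset V → Prop) : Prop :=
  LinOrderOn Δ r ∧
  ∀ D, Δ.Chamber D → (∃ E, Δ.Chamber E ∧ E ≠ D ∧ r E D) →
    (∃ F, F ⊆ D ∧ EarlierFace Δ r D F) ∧
    (∀ F, F ⊆ D → (EarlierFace Δ r D F ↔
      ∃ G, Δ.IsFacetOf G D ∧ F ⊆ G ∧ EarlierFace Δ r D G))

namespace Cplx

variable {V : Type*} [DecidableEq V] {Δ : Cplx V} {n k : ℕ} {D E P : Finset V}

theorem Adjacent.symm (hpure : Δ.Pure n) (h : Δ.Adjacent D E) : Δ.Adjacent E D := by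
  obtain ⟨hD, hE, hne, G, hGD, hGE, hG⟩ := h
  exact ⟨hE, hD, hne.symm, G, hGE, hGD, by rw [hG, hpure D hD, hpure E hE]⟩

/-- A face common to two adjacent chambers lies in their common facet. -/
theorem Adjacent.exists_facet (hpure : Δ.Pure n) (h : Δ.Adjacent D E) :
    ∃ G, Δ.IsFacetOf G E ∧ G ⊆ D ∧ ∀ F, F ⊆ D → F ⊆ E → F ⊆ G := by
  obtain ⟨hD, hE, hne, G, hGD, hGE, hG⟩ := h
  have hlt : (D ∩ E).card < D.card := by
    refine Finset.card_lt_card ⟨Finset.inter_subset_left, fun hsub => hne ?_⟩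
    exact (hD.2 E hE.1 (hsub.trans Finset.inter_subset_right)).symm
  have hGeq : G = D ∩ E :=
    Finset.eq_of_subset_of_card_le (Finset.subset_inter hGD hGE) (by omega)
  refine ⟨G, ⟨hGE, by rw [hG, hpure D hD, hpure E hE]⟩, hGD, fun F hFD hFE => ?_⟩
  exact hGeq ▸ Finset.subset_inter hFD hFE

theorem HasGallery.symm (hpure : Δ.Pure n) (h : Δ.HasGallery D E k) :
    Δ.HasGallery E D k := by
  obtain ⟨g, h0, hk, hch, hadj⟩ := h
  refine ⟨fun i => g (k - i), by simpa using hk, by simpa using h0,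
    fun i _ => hch _ (Nat.sub_le k i), fun i hi => ?_⟩
  have := (hadj (k - (i + 1)) (by omega)).symm hpure
  rwa [show k - (i + 1) + 1 = k - i by omega] at this

theorem HasGallery.snoc (h : Δ.HasGallery P D k) (hDE : Δ.Adjacent D E) :
    Δ.HasGallery P E (k + 1) := by
  obtain ⟨g, h0, hk, hch, hadj⟩ := h
  refine ⟨fun i => if i ≤ k then g i else E, by simpa using h0, by simp, fun i _ => ?_,
    fun i hi => ?_⟩
  · by_cases hik : i ≤ k
    · simpa [hik] using hch i hik
    · simpa [hik] using hDE.2.1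
  · by_cases hik : i < k
    · simpa [hik.le, Nat.succ_le_of_lt hik] using hadj i hik
    · obtain rfl : i = k := by omega
      simpa [hk] using hDE

theorem HasGallery.gdist_le (h : Δ.HasGallery D E k) : Δ.gdist D E ≤ k :=
  Nat.sInf_le h

theorem GalleryConnected.hasGallery_gdist (hconn : Δ.GalleryConnected) (hD : Δ.Chamber D)
    (hE : Δ.Chamber E) : Δ.HasGallery D E (Δ.gdist D E) :=
  Nat.sInf_mem (hconn D E hD hE)

theorem gdist_comm (hpure : Δ.Pure n) (D E : Finset V) : Δ.gdist D E = Δ.gdist E D := by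
  unfold gdist
  congr 1
  ext k
  exact ⟨fun h => h.symm hpure, fun h => h.symm hpure⟩

theorem GalleryConnected.eq_of_gdist_eq_zero (hconn : Δ.GalleryConnected)
    (hD : Δ.Chamber D) (hE : Δ.Chamber E) (h : Δ.gdist D E = 0) : D = E := by
  obtain ⟨g, h0, hk, -, -⟩ := hconn.hasGallery_gdist hD hE
  rw [← h0, ← hk, h]

theorem Adjacent.gdist_eq_one (hconn : Δ.GalleryConnected) (h : Δ.Adjacent D E) :
    Δ.gdist D E = 1 := by
  have hD : Δ.HasGallery D D 0 :=
    ⟨fun _ => D, rfl, rfl, fun _ _ => h.1, fun _ hi => absurd hi (Nat.not_lt_zero _)⟩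
  have hle := (hD.snoc h).gdist_le
  have hne : Δ.gdist D E ≠ 0 := fun h0 => h.2.2.1 (hconn.eq_of_gdist_eq_zero h.1 h.2.1 h0)
  omega

/-- The penultimate chamber of a geodesic gallery. -/
theorem GalleryConnected.exists_adjacent_gdist (hconn : Δ.GalleryConnected)
    (hP : Δ.Chamber P) (hD : Δ.Chamber D) (hne : P ≠ D) :
    ∃ X, Δ.Adjacent X D ∧ Δ.gdist P X + 1 = Δ.gdist P D := by
  have hpos : Δ.gdist P D ≠ 0 := fun h => hne (hconn.eq_of_gdist_eq_zero hP hD h)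
  obtain ⟨g, h0, hk, hch, hadj⟩ := hconn.hasGallery_gdist hP hD
  set k := Δ.gdist P D with hkdef
  have hX : Δ.Adjacent (g (k - 1)) D := by
    have := hadj (k - 1) (by omega)
    rwa [show k - 1 + 1 = k by omega, hk] at this
  have hle : Δ.gdist P (g (k - 1)) ≤ k - 1 :=
    HasGallery.gdist_le ⟨g, h0, rfl, fun i hi => hch i (by omega),
      fun i hi => hadj i (by omega)⟩
  have hge := ((hconn.hasGallery_gdist hP hX.1).snoc hX).gdist_le
  exact ⟨_, hX, by omega⟩

/-- Stars of faces are convex: the penultimate chamber of a geodesic between two chambers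
containing `F` contains `F`. -/
theorem GateProperty.subset_of_adjacent (hpure : Δ.Pure n) (hconn : Δ.GalleryConnected)
    (hgate : Δ.GateProperty) {F X : Finset V} (hP : Δ.Chamber P) (hFP : F ⊆ P)
    (hFD : F ⊆ D) (hX : Δ.Adjacent X D) (hd : Δ.gdist P X + 1 = Δ.gdist P D) : F ⊆ X := by
  obtain ⟨Q, hQ, hFQ, hgateQ⟩ := hgate F (Δ.down_closed P hP.1 F hFP) X hX.1
  have hXD := hgateQ D hX.2.1 hFD
  have hXP := hgateQ P hP hFP
  rw [hX.gdist_eq_one hconn] at hXD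
  by_cases hXQ : Δ.gdist X Q = 0
  · rwa [hconn.eq_of_gdist_eq_zero hX.1 hQ hXQ]
  · have hQD := hconn.eq_of_gdist_eq_zero hQ hX.2.1 (by omega)
    subst hQD
    rw [gdist_comm hpure X P, gdist_comm hpure Q P] at hXP
    omega

theorem GateProperty.isShelling (hpure : Δ.Pure n) (hconn : Δ.GalleryConnected)
    (hgate : Δ.GateProperty) {C : Finset V} (hC : Δ.Chamber C)
    {r : Finset V → Finset V → Prop} (hr : LinOrderOn Δ r)
    (hext : ∀ D E, Δ.Chamber D → Δ.Chamber E →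
      Δ.gdist C D + Δ.gdist D E = Δ.gdist C E → r D E) : IsShelling Δ r := by
  refine ⟨hr, fun D hD ⟨E, hE, hED, hrED⟩ =>
    ⟨⟨∅, Finset.empty_subset _, E, hE, hED, hrED, Finset.empty_subset _⟩, fun F hFD => ⟨?_, ?_⟩⟩⟩
  · rintro ⟨E, hE, hED, hrED, hFE⟩
    obtain ⟨P, hP, hFP, hgateP⟩ := hgate F (Δ.down_closed D hD.1 F hFD) C hC
    have hPD : P ≠ D := by
      rintro rfl
      exact hED (hr.2.1 E P hE hP hrED (hext P E hP hE (hgateP E hE hFE).symm))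
    obtain ⟨X, hX, hd⟩ := hconn.exists_adjacent_gdist hP hD hPD
    have hFX := hgate.subset_of_adjacent hpure hconn hP hFP hFD hX hd
    obtain ⟨G, hG, hGX, hGmax⟩ := hX.exists_facet hpure
    refine ⟨G, hG, hGmax F hFX hFD, X, hX.1, hX.2.2.1, hext X D hX.1 hD ?_, hGX⟩
    rw [hX.gdist_eq_one hconn, hgateP X hX.1 hFX, hgateP D hD hFD]
    omega
  · rintro ⟨G, -, hFG, E, hE, hED, hrED, hGE⟩
    exact ⟨E, hE, hED, hrED, hFG.trans hGE⟩

theorem GalleryConnected.exists_linOrderOn (hconn : Δ.GalleryConnected) (C : Finset V) :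
    ∃ r, LinOrderOn Δ r ∧ ∀ D E, Δ.Chamber D → Δ.Chamber E →
      Δ.gdist C D + Δ.gdist D E = Δ.gdist C E → r D E := by
  let key : Finset V → ℕ ×ₗ Cardinal := fun D => toLex (Δ.gdist C D, embeddingToCardinal D)
  have hkey : Function.Injective key := fun D E h =>
    embeddingToCardinal.injective (Prod.ext_iff.1 (toLex.injective h)).2
  refine ⟨fun D E => key D ≤ key E, ⟨fun _ _ => le_rfl, fun _ _ _ _ h h' =>
    hkey (le_antisymm h h'), fun _ _ _ _ _ _ => le_trans, fun _ _ _ _ => le_total _ _⟩,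
    fun D E hD hE h => ?_⟩
  by_cases h0 : Δ.gdist D E = 0
  · rw [hconn.eq_of_gdist_eq_zero hD hE h0]
  · exact Prod.Lex.toLex_le_toLex.2 (Or.inl (by dsimp only; omega))

theorem exists_chamber (Δ : Cplx V) : ∃ C, Δ.Chamber C := by
  obtain ⟨C, hC⟩ := Δ.faces.exists_maximal ⟨∅, Δ.empty_mem⟩
  exact ⟨C, hC.1, fun E hE h => (hC.eq_of_le hE h).symm⟩

end Cplx

/-- For a finite chamber complex with the gate property, every linear extension of the
geodesic partial order `≤_C` (`D ≤_C E` iff `d(C,D) + d(D,E) = d(C,E)`) is a shelling;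
in particular every finite chamber complex with the gate property is shellable. -/
theorem stmt_4 {V : Type*} [DecidableEq V] (Δ : Cplx V) (d : ℕ)
    (hpure : Δ.Pure (d + 1)) (hconn : Cplx.GalleryConnected Δ)
    (hgate : Cplx.GateProperty Δ) :
    (∀ C, Δ.Chamber C → ∀ r, LinOrderOn Δ r →
      (∀ D E, Δ.Chamber D → Δ.Chamber E →
        Δ.gdist C D + Δ.gdist D E = Δ.gdist C E → r D E) →
      IsShelling Δ r) ∧
    ∃ r, IsShelling Δ r := by
  refine ⟨fun C hC r hr hext => hgate.isShelling hpure hconn hC hr hext, ?_⟩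
  obtain ⟨C, hC⟩ := Δ.exists_chamber
  obtain ⟨r, hr, hext⟩ := hconn.exists_linOrderOn C
  exact ⟨r, hgate.isShelling hpure hconn hC hr hext⟩
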